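/- For z ∈ ℝ^{2n} and w ∈ ℝ with (z,w) ≠ (0,0), the 2n×2n matrix M(z,w) = |z|² I_{2n} + a w J + (2 − (β+4)|z|⁴/(|z|⁴+w²)) z zᵀ satisfies det M(z,w) = ((|z|⁴ + a²w²)^{n−1}/(|z|⁴ + w²)) · ( −(β+1)|z|⁸ + (a²+3)|z|⁴w² + a²w⁴ ). -/

import Mathlib

noncomputable section

/-- The standard `2n × 2n` block matrix `[[0, Iₙ],[−Iₙ, 0]]`. -/
def Jmat (n : ℕ) : Matrix (Fin (2*n)) (Fin (2*n)) ℝ :=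
  Matrix.of fun i j =>
    if (i : ℕ) < n ∧ (j : ℕ) = (i : ℕ) + n then 1
    else if n ≤ (i : ℕ) ∧ (i : ℕ) = (j : ℕ) + n then -1 else 0

/-- The matrix `M(z,w) = |z|² I_{2n} + a w J + (2 − (β+4)|z|⁴/(|z|⁴+w²)) z zᵀ`. -/
def Mmat (n : ℕ) (a β : ℝ) (z : Fin (2*n) → ℝ) (w : ℝ) :
    Matrix (Fin (2*n)) (Fin (2*n)) ℝ :=
  (∑ i, z i ^ 2) • (1 : Matrix (Fin (2*n)) (Fin (2*n)) ℝ)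
    + (a * w) • Jmat n
    + (2 - (β + 4) * (∑ i, z i ^ 2) ^ 2 / ((∑ i, z i ^ 2) ^ 2 + w ^ 2))
        • Matrix.of (fun i j => z i * z j)

open Matrix Kronecker

theorem Jmat_submatrix (n : ℕ) :
    (Jmat n).submatrix finProdFinEquiv finProdFinEquiv
      = !![0, 1; -1, 0] ⊗ₖ (1 : Matrix (Fin n) (Fin n) ℝ) := by
  ext ⟨i, k⟩ ⟨j, l⟩
  have hk := k.isLt
  have hl := l.isLt
  fin_cases i <;> fin_cases j <;>
    simp [Jmat, Matrix.one_apply, finProdFinEquiv, Fin.ext_iff] <;> grind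

theorem Jmat_mul_self (n : ℕ) : Jmat n * Jmat n = -1 := by
  have h : (Jmat n * Jmat n).submatrix finProdFinEquiv finProdFinEquiv
      = (-1 : Matrix (Fin (2 * n)) (Fin (2 * n)) ℝ).submatrix
          finProdFinEquiv finProdFinEquiv := by
    rw [← Matrix.submatrix_mul_equiv _ _ _ finProdFinEquiv, Jmat_submatrix,
      ← Matrix.mul_kronecker_mul]
    ext ⟨i, k⟩ ⟨j, l⟩
    fin_cases i <;> fin_cases j <;> simp [Matrix.one_apply, apply_ite]
  exact (Matrix.reindex finProdFinEquiv.symm finProdFinEquiv.symm).injective h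

theorem Jmat_transpose (n : ℕ) : (Jmat n)ᵀ = -Jmat n := by
  ext i j
  simp only [Jmat, Matrix.transpose_apply, Matrix.of_apply, Matrix.neg_apply]
  grind

theorem dotProduct_Jmat_mulVec_self (n : ℕ) (z : Fin (2 * n) → ℝ) :
    z ⬝ᵥ Jmat n *ᵥ z = 0 := by
  have h : z ⬝ᵥ Jmat n *ᵥ z = -(z ⬝ᵥ Jmat n *ᵥ z) := by
    conv_lhs => rw [Matrix.dotProduct_mulVec, ← Matrix.mulVec_transpose, Jmat_transpose,
      Matrix.neg_mulVec, neg_dotProduct, dotProduct_comm]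
  linarith

theorem det_smul_one_add_smul_Jmat (n : ℕ) (s b : ℝ) :
    (s • (1 : Matrix (Fin (2 * n)) (Fin (2 * n)) ℝ) + b • Jmat n).det = (s ^ 2 + b ^ 2) ^ n := by
  have h : (s • (1 : Matrix (Fin (2 * n)) (Fin (2 * n)) ℝ) + b • Jmat n).submatrix
      finProdFinEquiv finProdFinEquiv
      = !![s, b; -b, s] ⊗ₖ (1 : Matrix (Fin n) (Fin n) ℝ) := by
    rw [Matrix.submatrix_add, Matrix.submatrix_smul, Matrix.submatrix_smul, Pi.add_apply,
      Pi.add_apply, Pi.smul_apply, Pi.smul_apply, Pi.smul_apply, Pi.smul_apply, Jmat_submatrix]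
    ext ⟨i, k⟩ ⟨j, l⟩
    fin_cases i <;> fin_cases j <;> simp [Matrix.one_apply]
  rw [← Matrix.det_submatrix_equiv_self finProdFinEquiv, h, Matrix.det_kronecker]
  simp [Matrix.det_fin_two, sq]

theorem inv_smul_one_add_smul_Jmat (n : ℕ) {s b : ℝ} (h : s ^ 2 + b ^ 2 ≠ 0) :
    (s • (1 : Matrix (Fin (2 * n)) (Fin (2 * n)) ℝ) + b • Jmat n)⁻¹
      = (s ^ 2 + b ^ 2)⁻¹ • (s • 1 - b • Jmat n) := by
  apply Matrix.inv_eq_right_inv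
  have hmul : (s • (1 : Matrix (Fin (2 * n)) (Fin (2 * n)) ℝ) + b • Jmat n)
      * (s • 1 - b • Jmat n) = (s ^ 2 + b ^ 2) • 1 := by
    simp only [add_mul, mul_sub, smul_mul_assoc, mul_smul_comm, one_mul, mul_one, Jmat_mul_self]
    module
  rw [mul_smul_comm, hmul, smul_smul, inv_mul_cancel₀ h, one_smul]

theorem det_smul_one_add_smul_Jmat_add_smul_vecMulVec (n : ℕ) {s b : ℝ}
    (h : s ^ 2 + b ^ 2 ≠ 0) (c : ℝ) (z : Fin (2 * n) → ℝ) :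
    (s • (1 : Matrix (Fin (2 * n)) (Fin (2 * n)) ℝ) + b • Jmat n + c • vecMulVec z z).det
      = (s ^ 2 + b ^ 2) ^ n * (1 + c * s * (z ⬝ᵥ z) / (s ^ 2 + b ^ 2)) := by
  have hA := det_smul_one_add_smul_Jmat n s b
  have hu : IsUnit (s • (1 : Matrix (Fin (2 * n)) (Fin (2 * n)) ℝ) + b • Jmat n).det := by
    rw [hA]
    exact (pow_ne_zero n h).isUnit
  rw [← Matrix.smul_vecMulVec, Matrix.vecMulVec_eq Unit,
    Matrix.det_add_replicateCol_mul_replicateRow hu, hA, inv_smul_one_add_smul_Jmat n h,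
    Matrix.det_unique, Matrix.add_apply, Matrix.one_apply_eq, Matrix.mul_assoc,
    ← Matrix.replicateCol_mulVec, Matrix.replicateRow_mul_replicateCol_apply]
  simp only [Matrix.smul_mulVec, Matrix.sub_mulVec, Matrix.one_mulVec, Matrix.mulVec_smul,
    dotProduct_smul, dotProduct_sub, dotProduct_Jmat_mulVec_self, smul_eq_mul]
  ring

/-- `det M(z,w) = ((|z|⁴ + a²w²)^{n−1}/(|z|⁴ + w²)) ·
(−(β+1)|z|⁸ + (a²+3)|z|⁴w² + a²w⁴)`. -/
theorem det_M (n : ℕ) (hn : 1 ≤ n) (a : ℝ) (ha : a ≠ 0) (β : ℝ)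
    (z : Fin (2*n) → ℝ) (w : ℝ) (hzw : (z, w) ≠ (0, 0)) :
    (Mmat n a β z w).det
      = ((∑ i, z i ^ 2) ^ 2 + a ^ 2 * w ^ 2) ^ (n - 1)
          / ((∑ i, z i ^ 2) ^ 2 + w ^ 2)
        * (-(β + 1) * (∑ i, z i ^ 2) ^ 4
            + (a ^ 2 + 3) * (∑ i, z i ^ 2) ^ 2 * w ^ 2 + a ^ 2 * w ^ 4) := by
  have hz : z ⬝ᵥ z = ∑ i, z i ^ 2 := by simp [dotProduct, sq]
  have hpos : ∀ t : ℝ, t ≠ 0 → (∑ i, z i ^ 2) ^ 2 + (t * w) ^ 2 ≠ 0 := by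
    intro t ht h0
    have hs : ∑ i, z i ^ 2 = 0 := by nlinarith [sq_nonneg (∑ i, z i ^ 2), sq_nonneg (t * w)]
    have hw : t * w = 0 := by nlinarith [sq_nonneg (∑ i, z i ^ 2), sq_nonneg (t * w)]
    exact hzw (Prod.ext (dotProduct_self_eq_zero.mp (hz.trans hs))
      ((mul_eq_zero.mp hw).resolve_left ht))
  have hD := hpos a ha
  have hE : (∑ i, z i ^ 2) ^ 2 + w ^ 2 ≠ 0 := by simpa using hpos 1 one_ne_zero
  have hM := det_smul_one_add_smul_Jmat_add_smul_vecMulVec n hD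
    (2 - (β + 4) * (∑ i, z i ^ 2) ^ 2 / ((∑ i, z i ^ 2) ^ 2 + w ^ 2)) z
  rw [hz] at hM
  refine hM.trans ?_
  obtain ⟨m, rfl⟩ := Nat.exists_eq_add_of_le' hn
  generalize ∑ i, z i ^ 2 = s at *
  rw [mul_pow] at hD
  rw [Nat.add_sub_cancel, pow_succ, mul_pow]
  field_simp
  ring

end
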